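/- arXiv:2110.15035 — 5 statements merged into one kernel-verified Lean document; each statement's English description precedes it below -/
import Mathlib

section
/- Fix integers d ≥ 1 and 0 ≤ i ≤ d. Then the sequence q ↦ d! · a_q(i,0;d) / q^d (of real numbers, indexed by positive integers q) converges, as q → ∞, to the Eulerian number A(d,i) = ∑_{j=0}^{i} (−1)^{i−j} · C(d+1, i−j) · j^d. -/
open Finset

/-- `aCount q d i m` is the number of `(d+1)`-tuples `(i_0, …, i_d)` of integers with
`0 ≤ i_j ≤ q - 1` for every `j` and `i_0 + ⋯ + i_d = m + i * q`. -/
noncomputable def aCount (q d : ℕ) (i m : ℤ) : ℕ :=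
  ((Fintype.piFinset fun _ : Fin (d + 1) => Finset.Icc (0 : ℤ) ((q : ℤ) - 1)).filter
    (fun f => ∑ j, f j = m + i * q)).card

open scoped PowerSeries in
/-- The geometric sum `1 + X + ⋯ + X ^ (q - 1)`, indexed by an integer interval. -/
lemma sum_Icc_X_pow_toNat (q : ℕ) :
    ∑ z ∈ Finset.Icc (0 : ℤ) ((q : ℤ) - 1), (PowerSeries.X : ℝ⟦X⟧) ^ z.toNat =
      ∑ k ∈ Finset.range q, (PowerSeries.X : ℝ⟦X⟧) ^ k := by
  refine Finset.sum_nbij' (fun z => z.toNat) (fun k => (k : ℤ)) ?_ ?_ ?_ ?_ ?_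
  · intro z hz
    simp only [Finset.mem_Icc, Finset.mem_range] at *
    omega
  · intro k hk
    simp only [Finset.mem_Icc, Finset.mem_range] at *
    omega
  · intro z hz
    simp only [Finset.mem_Icc] at *
    omega
  · simp
  · simp

open scoped PowerSeries in
lemma aCount_eq_coeff (q d i : ℕ) :
    (aCount q d (i : ℤ) 0 : ℝ) =
      PowerSeries.coeff (i * q)
        ((∑ k ∈ Finset.range q, (PowerSeries.X : ℝ⟦X⟧) ^ k) ^ (d + 1)) := by
  have hprod := Finset.prod_univ_sum
    (fun _ : Fin (d + 1) => Finset.Icc (0 : ℤ) ((q : ℤ) - 1))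
    (fun _ z => (PowerSeries.X : ℝ⟦X⟧) ^ z.toNat)
  rw [Finset.prod_const, Finset.card_univ, Fintype.card_fin, sum_Icc_X_pow_toNat] at hprod
  rw [hprod, map_sum, aCount, Finset.card_filter, Nat.cast_sum]
  refine Finset.sum_congr rfl fun f hf => ?_
  have hsum : ∑ j, f j = ((∑ j, (f j).toNat : ℕ) : ℤ) := by
    rw [Nat.cast_sum]
    refine Finset.sum_congr rfl fun j _ => ?_
    have hj := Fintype.mem_piFinset.1 hf j
    rw [Finset.mem_Icc] at hj
    omega
  rw [Finset.prod_pow_eq_pow_sum, PowerSeries.coeff_X_pow, hsum, zero_add]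
  norm_cast
  simp only [eq_comm]

open scoped PowerSeries in
lemma geom_sum_X_pow_eq (q d : ℕ) :
    (∑ k ∈ Finset.range q, (PowerSeries.X : ℝ⟦X⟧) ^ k) ^ (d + 1) =
      (1 - PowerSeries.X ^ q) ^ (d + 1) *
        PowerSeries.mk fun n => ((d + n).choose d : ℝ) := by
  rw [← geom_sum_mul_neg, mul_pow, mul_assoc, mul_comm ((1 - PowerSeries.X) ^ (d + 1)),
    PowerSeries.mk_add_choose_mul_one_sub_pow_eq_one, mul_one]

/-- Inclusion–exclusion formula for `aCount`. -/
lemma aCount_eq_sum (q d i : ℕ) (hq : 0 < q) (hi : i ≤ d) :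
    (aCount q d (i : ℤ) 0 : ℝ) =
      ∑ j ∈ Finset.range (i + 1),
        (-1 : ℝ) ^ (i - j) * ((d + 1).choose (i - j) : ℝ) * ((j * q + d).choose d : ℝ) := by
  rw [aCount_eq_coeff, geom_sum_X_pow_eq, sub_eq_neg_add, add_pow, Finset.sum_mul, map_sum]
  have hterm : ∀ k, PowerSeries.coeff (i * q) ((-PowerSeries.X ^ q) ^ k * 1 ^ (d + 1 - k) *
      ((d + 1).choose k : PowerSeries ℝ) * PowerSeries.mk fun n => ((d + n).choose d : ℝ)) =
      if k ≤ i then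
        (-1 : ℝ) ^ k * ((d + 1).choose k : ℝ) * (((i - k) * q + d).choose d : ℝ) else 0 := by
    intro k
    have hrw : (-PowerSeries.X ^ q) ^ k * 1 ^ (d + 1 - k) *
        ((d + 1).choose k : PowerSeries ℝ) * (PowerSeries.mk fun n => ((d + n).choose d : ℝ)) =
        PowerSeries.C ((-1 : ℝ) ^ k * ((d + 1).choose k : ℝ)) * (PowerSeries.X ^ (k * q) *
          PowerSeries.mk fun n => ((d + n).choose d : ℝ)) := by
      rw [neg_pow, ← pow_mul, mul_comm q k]
      simp only [map_mul, map_pow, map_neg, map_one, map_natCast, one_pow]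
      ring
    rw [hrw, PowerSeries.coeff_C_mul, PowerSeries.coeff_X_pow_mul', PowerSeries.coeff_mk]
    simp only [Nat.mul_le_mul_right_iff hq, ← Nat.sub_mul, add_comm d, mul_ite, mul_zero]
  simp_rw [hterm]
  rw [← Finset.sum_filter]
  have hfilter : (Finset.range (d + 1 + 1)).filter (· ≤ i) = Finset.range (i + 1) := by
    ext k
    simp only [Finset.mem_filter, Finset.mem_range]
    omega
  rw [hfilter, ← Finset.sum_range_reflect]
  refine Finset.sum_congr rfl fun j hj => ?_
  have hj' := Finset.mem_range.1 hj
  rw [show i + 1 - 1 - j = i - j by omega, show i - (i - j) = j by omega]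

lemma tendsto_factorial_mul_choose_div_pow (d j : ℕ) :
    Filter.Tendsto
      (fun q : ℕ => (d.factorial : ℝ) * ((j * q + d).choose d : ℝ) / (q : ℝ) ^ d)
      Filter.atTop (nhds ((j : ℝ) ^ d)) := by
  have hfactor : ∀ l : ℕ, Filter.Tendsto (fun q : ℕ => (j : ℝ) + ((1 + l : ℕ) : ℝ) / (q : ℝ))
      Filter.atTop (nhds (j : ℝ)) := fun l => by
    simpa using (tendsto_const_div_atTop_nhds_zero_nat ((1 + l : ℕ) : ℝ)).const_add (j : ℝ)
  have hprod := tendsto_finsetProd (Finset.range d) fun l _ => hfactor l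
  rw [Finset.prod_const, Finset.card_range] at hprod
  refine hprod.congr' ?_
  filter_upwards [Filter.eventually_gt_atTop 0] with q hq
  have hq' : (q : ℝ) ≠ 0 := by positivity
  have hpow : (q : ℝ) ^ d = ∏ _l ∈ Finset.range d, (q : ℝ) := by simp
  rw [hpow, ← Nat.cast_mul, ← Nat.ascFactorial_eq_factorial_mul_choose, Nat.ascFactorial_eq_prod_range,
    Nat.cast_prod, ← Finset.prod_div_distrib]
  refine Finset.prod_congr rfl fun l _ => ?_
  push_cast
  field_simp
  ring

theorem aCount_tendsto_eulerian (d i : ℕ) (hd : 1 ≤ d) (hi : i ≤ d) :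
    Filter.Tendsto
      (fun q : ℕ => (d.factorial : ℝ) * (aCount q d (i : ℤ) 0 : ℝ) / (q : ℝ) ^ d)
      Filter.atTop
      (nhds (∑ j ∈ Finset.range (i + 1),
        (-1 : ℝ) ^ (i - j) * ((d + 1).choose (i - j) : ℝ) * (j : ℝ) ^ d)) := by
  have hlim := tendsto_finsetSum (Finset.range (i + 1)) fun j _ =>
    (tendsto_factorial_mul_choose_div_pow d j).const_mul
      ((-1 : ℝ) ^ (i - j) * ((d + 1).choose (i - j) : ℝ))
  refine hlim.congr' ?_
  filter_upwards [Filter.eventually_gt_atTop 0] with q hq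
  rw [aCount_eq_sum q d i hq hi, Finset.mul_sum, Finset.sum_div]
  exact Finset.sum_congr rfl fun j _ => by ring
end

section
/- For all integers q ≥ 1, d ≥ 1 and 1 ≤ l ≤ d, one has ∑_{j=0}^{q−1} a_q(l−1, j; d−1) = a_q(l,0;d) − a_q(l,0;d−1) + a_q(l−1,0;d−1). -/
open Finset

/-- Splitting off the first entry of a tuple. -/
theorem aCount_succ (q d : ℕ) (i m : ℤ) :
    aCount q (d + 1) i m = ∑ k ∈ Finset.range q, aCount q d i (m - k) := by
  unfold aCount
  rw [← Finset.card_sigma]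
  symm
  refine Finset.card_bij (fun x _ => Fin.cons (x.1 : ℤ) x.2) ?_ ?_ ?_
  · rintro ⟨k, f⟩ h
    simp only [mem_sigma, mem_range, mem_filter, Fintype.mem_piFinset, mem_Icc] at h ⊢
    obtain ⟨hk, hf, hs⟩ := h
    refine ⟨fun a => ?_, ?_⟩
    · refine Fin.cases ?_ (fun b => ?_) a
      · simp only [Fin.cons_zero]
        omega
      · simpa only [Fin.cons_succ] using hf b
    · rw [Fin.sum_univ_succ]
      simp only [Fin.cons_zero, Fin.cons_succ]
      rw [hs]
      ring
  · rintro ⟨k, f⟩ _ ⟨k', f'⟩ _ h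
    obtain ⟨hk, hf⟩ := Fin.cons_inj.1 h
    obtain rfl : k = k' := by exact_mod_cast hk
    exact congrArg (Sigma.mk k) hf
  · intro g hg
    simp only [mem_filter, Fintype.mem_piFinset, mem_Icc] at hg
    obtain ⟨hb, hs⟩ := hg
    have h0 := hb 0
    have hcast : ((g 0).toNat : ℤ) = g 0 := Int.toNat_of_nonneg h0.1
    refine ⟨⟨(g 0).toNat, Fin.tail g⟩, ?_, ?_⟩
    · simp only [mem_sigma, mem_range, mem_filter, Fintype.mem_piFinset, mem_Icc]
      refine ⟨by omega, fun a => hb a.succ, ?_⟩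
      rw [Fin.sum_univ_succ] at hs
      simp only [Fin.tail, hcast]
      linarith
    · simp only [hcast]
      exact Fin.cons_self_tail g

/-- The count depends only on the target sum `m + i * q`. -/
theorem aCount_eq_sub_one (q d : ℕ) (i m : ℤ) :
    aCount q d i m = aCount q d (i - 1) (m + q) := by
  unfold aCount
  rw [show m + q + (i - 1) * q = m + i * q by ring]

theorem aCount_column_sum (q d l : ℕ) (hq : 1 ≤ q) (hd : 1 ≤ d) (hl1 : 1 ≤ l) (hl2 : l ≤ d) :
    (∑ j ∈ Finset.range q, (aCount q (d - 1) ((l : ℤ) - 1) (j : ℤ) : ℤ)) =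
      (aCount q d (l : ℤ) 0 : ℤ) - (aCount q (d - 1) (l : ℤ) 0 : ℤ) +
        (aCount q (d - 1) ((l : ℤ) - 1) 0 : ℤ) := by
  obtain ⟨d, rfl⟩ := Nat.exists_eq_add_of_le' hd
  simp only [Nat.add_sub_cancel]
  have hsplit : aCount q (d + 1) l 0 =
      ∑ j ∈ Finset.range q, aCount q d ((l : ℤ) - 1) ((j + 1 : ℕ) : ℤ) := by
    rw [aCount_succ, ← Finset.sum_range_reflect]
    refine Finset.sum_congr rfl fun k hk => ?_
    have hk := Finset.mem_range.1 hk
    rw [aCount_eq_sub_one]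
    congr 1
    omega
  have hshift : aCount q d l 0 = aCount q d ((l : ℤ) - 1) (q : ℤ) := by
    rw [aCount_eq_sub_one, zero_add]
  have hsucc := Finset.sum_range_succ (fun j : ℕ => (aCount q d ((l : ℤ) - 1) j : ℤ)) q
  rw [Finset.sum_range_succ'] at hsucc
  rw [hsplit, hshift]
  push_cast at hsucc ⊢
  linarith
end

section
/- Let q ≥ 1, d ≥ 2 and 1 ≤ r ≤ d−1 be integers, and for 0 ≤ i ≤ r and 0 ≤ k ≤ d−r set b_{i,k} = a_q(k,0;d−r)·a_q(i,0;r−1) + ∑_{j=1}^{q−1} a_q(k,j;d−r)·a_q(i−1, q−j; r−1), where terms with first argument −1 are zero. Then for every 0 ≤ l ≤ d one has ∑_{i+k=l, 0≤i≤r, 0≤k≤d−r} b_{i,k} = a_q(l,0;d). -/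
open Finset

/-- The number of `n`-tuples of integers in `[0, q - 1]` with sum `s`. -/
noncomputable def boxSumCount (q n : ℕ) (s : ℤ) : ℕ :=
  ((Fintype.piFinset fun _ : Fin n => Finset.Icc (0 : ℤ) ((q : ℤ) - 1)).filter
    (fun f => ∑ j, f j = s)).card

theorem aCount_eq_boxSumCount (q d : ℕ) (i m : ℤ) :
    aCount q d i m = boxSumCount q (d + 1) (m + i * q) := rfl

theorem boxSumCount_of_neg (q n : ℕ) {s : ℤ} (hs : s < 0) : boxSumCount q n s = 0 := by
  rw [boxSumCount, card_eq_zero, filter_eq_empty_iff]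
  intro f hf h
  simp only [Fintype.mem_piFinset, mem_Icc] at hf
  have : 0 ≤ ∑ j, f j := sum_nonneg fun j _ => (hf j).1
  omega

theorem boxSumCount_of_gt (q n : ℕ) {s : ℤ} (hs : (n : ℤ) * (q - 1) < s) :
    boxSumCount q n s = 0 := by
  rw [boxSumCount, card_eq_zero, filter_eq_empty_iff]
  intro f hf h
  simp only [Fintype.mem_piFinset, mem_Icc] at hf
  have : ∑ j, f j ≤ ∑ _j : Fin n, ((q : ℤ) - 1) := sum_le_sum fun j _ => (hf j).2
  simp only [sum_const, card_univ, Fintype.card_fin, nsmul_eq_mul] at this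
  omega

theorem boxSumCount_add (q m n : ℕ) (hm : 1 ≤ m) (t : ℤ) :
    boxSumCount q (m + n) t =
      ∑ s ∈ range (m * q), boxSumCount q m s * boxSumCount q n (t - s) := by
  rw [boxSumCount, card_eq_sum_card_fiberwise
    (f := fun f : Fin (m + n) → ℤ => (∑ j : Fin m, f (Fin.castAdd n j)).toNat)
    (t := range (m * q))]
  · refine sum_congr rfl fun s _ => ?_
    rw [boxSumCount, boxSumCount, ← card_product]
    refine card_bij' (fun f _ => (fun j => f (Fin.castAdd n j), fun j => f (Fin.natAdd m j)))
      (fun g _ => Fin.append g.1 g.2) ?_ ?_ ?_ ?_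
    · intro f hf
      simp only [mem_filter, Fintype.mem_piFinset, mem_Icc, Fin.sum_univ_add, mem_product] at hf ⊢
      have : 0 ≤ ∑ j : Fin m, f (Fin.castAdd n j) := sum_nonneg fun j _ => (hf.1.1 _).1
      refine ⟨⟨fun j => hf.1.1 _, by omega⟩, fun j => hf.1.1 _, by omega⟩
    · intro g hg
      simp only [mem_filter, Fintype.mem_piFinset, mem_Icc, Fin.sum_univ_add, mem_product,
        Fin.append_left, Fin.append_right] at hg ⊢
      refine ⟨⟨fun j => ?_, by omega⟩, by omega⟩
      refine Fin.addCases (fun j => ?_) (fun j => ?_) j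
      · simpa using hg.1.1 j
      · simpa using hg.2.1 j
    · intro f _
      exact Fin.append_castAdd_natAdd
    · intro g _
      simp
  · intro f hf
    simp only [coe_filter, Set.mem_ofPred_eq, Fintype.mem_piFinset, mem_Icc] at hf
    have h : ∑ j : Fin m, f (Fin.castAdd n j) ≤ ∑ _j : Fin m, ((q : ℤ) - 1) :=
      sum_le_sum fun j _ => (hf.1 _).2
    simp only [sum_const, card_univ, Fintype.card_fin, nsmul_eq_mul] at h
    have hq := hf.1 (Fin.castAdd n ⟨0, hm⟩)
    have hpos : 0 < m * q := Nat.mul_pos hm (by omega)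
    simp only [coe_range, Set.mem_Iio]
    zify at hpos hm ⊢
    rw [Int.ofNat_toNat]
    exact max_lt (by nlinarith) hpos

theorem sum_range_mul_eq_sum_sum {M : Type*} [AddCommMonoid M] (m q : ℕ) (f : ℕ → M) :
    ∑ s ∈ range (m * q), f s = ∑ k ∈ range m, ∑ j ∈ range q, f (k * q + j) := by
  induction m with
  | zero => simp
  | succ m ih => rw [Nat.succ_mul, sum_range_add, ih, sum_range_succ]

theorem blowup_b_sum_diagonal (q d r : ℕ) (hq : 1 ≤ q) (hd : 2 ≤ d) (hr1 : 1 ≤ r)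
    (hr2 : r ≤ d - 1) (b : ℕ → ℕ → ℤ)
    (hb : ∀ i k, b i k =
      (aCount q (d - r) (k : ℤ) 0 : ℤ) * (aCount q (r - 1) (i : ℤ) 0 : ℤ) +
        ∑ j ∈ Finset.Ico 1 q,
          (aCount q (d - r) (k : ℤ) (j : ℤ) : ℤ) *
            (aCount q (r - 1) ((i : ℤ) - 1) ((q : ℤ) - (j : ℤ)) : ℤ))
    (l : ℕ) (hl : l ≤ d) :
    (∑ p ∈ (Finset.range (r + 1) ×ˢ Finset.range (d - r + 1)).filter
        (fun p => p.1 + p.2 = l), b p.1 p.2) = (aCount q d (l : ℤ) 0 : ℤ) := by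
  have hb' : ∀ i k, b i k = ∑ j ∈ range q,
      (boxSumCount q (d - r + 1) (k * q + j) : ℤ) * boxSumCount q r (i * q - j) := by
    intro i k
    rw [hb, range_eq_Ico, sum_eq_sum_Ico_succ_bot (show 0 < q from hq)]
    simp only [aCount_eq_boxSumCount, Nat.sub_add_cancel hr1]
    congr 1
    · simp
    · refine sum_congr rfl fun j _ => ?_
      congr 3 <;> ring
  rw [aCount_eq_boxSumCount, show d + 1 = (d - r + 1) + r by omega,
    boxSumCount_add _ _ _ (by omega), sum_range_mul_eq_sum_sum, sum_filter, sum_product_right]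
  push_cast
  refine sum_congr rfl fun k _ => ?_
  by_cases hk : k ≤ l ∧ l - k ≤ r
  · rw [sum_eq_single (l - k)]
    · rw [if_pos (by omega), hb']
      refine sum_congr rfl fun j _ => ?_
      push_cast [hk.1]
      congr 3
      ring
    · intro i _ hi
      exact if_neg (by omega)
    · intro h
      simp only [mem_range] at h
      omega
  · rw [sum_eq_zero, sum_eq_zero]
    · intro j hj
      rw [mem_range] at hj
      rw [mul_eq_zero]
      right
      rw [Nat.cast_eq_zero]
      rcases lt_or_ge l k with h | h
      · apply boxSumCount_of_neg
        zify at h hq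
        nlinarith
      · apply boxSumCount_of_gt
        have h' : r + k + 1 ≤ l := by omega
        zify at h' hq hj
        nlinarith
    · intro i hi
      rw [mem_range] at hi
      exact if_neg (by omega)
end

section
/- Let q ≥ 1, d ≥ 2 and 1 ≤ r ≤ d−1 be integers, and for 0 ≤ i ≤ r and 0 ≤ k ≤ d−r set b_{i,k} = a_q(k,0;d−r)·a_q(i,0;r−1) + ∑_{j=1}^{q−1} a_q(k,j;d−r)·a_q(i−1, q−j; r−1). Then for every 0 ≤ k ≤ d−r one has ∑_{i=0}^{r} b_{i,k} = q^{r−1} · ∑_{j=0}^{q−1} a_q(k,j;d−r) = q^{r−1} · ( a_q(k+1, 0; d−r+1) − a_q(k+1, 0; d−r) + a_q(k, 0; d−r) ). -/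
open Finset

/-- The number of `n`-tuples of integers in `[0, q - 1]` with sum `s`. -/
noncomputable def tupleSumCount (q n : ℕ) (s : ℤ) : ℕ :=
  ((Fintype.piFinset fun _ : Fin n => Finset.Icc (0 : ℤ) ((q : ℤ) - 1)).filter
    (fun f => ∑ j, f j = s)).card

theorem aCount_eq_tupleSumCount (q d : ℕ) (i m : ℤ) :
    aCount q d i m = tupleSumCount q (d + 1) (m + i * q) := rfl

theorem tupleSumCount_succ (q n : ℕ) (s : ℤ) :
    tupleSumCount q (n + 1) s = ∑ x ∈ range q, tupleSumCount q n (s - x) := by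
  unfold tupleSumCount
  rw [← card_sigma]
  refine card_bij' (fun f _ => ⟨(f 0).toNat, Fin.tail f⟩)
    (fun p _ => Fin.cons (p.1 : ℤ) p.2) ?_ ?_ ?_ ?_
  · intro f hf
    simp only [mem_filter, Fintype.mem_piFinset, mem_Icc, Fin.sum_univ_succ] at hf
    have h0 := hf.1 0
    simp only [mem_sigma, mem_range, mem_filter, Fintype.mem_piFinset, mem_Icc, Fin.tail]
    exact ⟨by omega, fun i => hf.1 i.succ, by omega⟩
  · rintro ⟨x, g⟩ hp
    simp only [mem_sigma, mem_range, mem_filter, Fintype.mem_piFinset, mem_Icc] at hp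
    simp only [mem_filter, Fintype.mem_piFinset, mem_Icc, Fin.sum_univ_succ, Fin.forall_fin_succ,
      Fin.cons_zero, Fin.cons_succ]
    exact ⟨⟨by omega, hp.2.1⟩, by omega⟩
  · intro f hf
    simp only [mem_filter, Fintype.mem_piFinset, mem_Icc] at hf
    simp only [Int.toNat_of_nonneg (hf.1 0).1, Fin.cons_self_tail]
  · rintro ⟨x, g⟩ _
    simp

/-- The tuples of length `n + 1` whose sum lies in a fixed residue class modulo `q`
number `q ^ n`. -/
theorem sum_tupleSumCount_residue (q n j : ℕ) (hj : j < q) :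
    ∑ i ∈ range (n + 2), tupleSumCount q (n + 1) (i * q - j) = q ^ n := by
  have hunique : ∀ f ∈ Fintype.piFinset fun _ : Fin n => Icc (0 : ℤ) ((q : ℤ) - 1),
      #{p ∈ range (n + 2) ×ˢ range q | ∑ l, f l = (p.1 : ℤ) * q - j - p.2} = 1 := by
    intro f hf
    simp only [Fintype.mem_piFinset, mem_Icc] at hf
    have hnonneg : 0 ≤ ∑ l, f l := sum_nonneg fun l _ => (hf l).1
    have hle : ∑ l, f l ≤ n * ((q : ℤ) - 1) := by
      simpa using sum_le_card_nsmul univ f ((q : ℤ) - 1) fun l _ => (hf l).2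
    obtain ⟨t, ht⟩ := Int.eq_ofNat_of_zero_le hnonneg
    rw [ht] at hle ⊢
    have hmod := Nat.mod_lt (t + j + (q - 1)) (by omega : 0 < q)
    have hdiv := Nat.div_add_mod (t + j + (q - 1)) q
    have hlt : (t + j + (q - 1)) / q < n + 2 := by
      rw [Nat.div_lt_iff_lt_mul (by omega)]
      zify [(by omega : 1 ≤ q)]
      nlinarith
    set a := (t + j + (q - 1)) / q
    set c := (t + j + (q - 1)) % q
    rw [card_eq_one]
    refine ⟨(a, q - 1 - c), ?_⟩
    ext ⟨i, x⟩
    simp only [mem_filter, mem_product, mem_range, mem_singleton, Prod.mk.injEq]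
    constructor
    · rintro ⟨⟨hi, hx⟩, h⟩
      have h' : t + j + x = q * i := by zify; linarith
      have hia : a = i := by
        refine Nat.div_eq_of_lt_le ?_ ?_ <;> rw [mul_comm] <;> grind
      subst hia
      omega
    · rintro ⟨rfl, rfl⟩
      refine ⟨⟨hlt, by omega⟩, ?_⟩
      have : (q : ℤ) * a + c = t + j + (q - 1 : ℕ) := by exact_mod_cast hdiv
      push_cast [(by omega : 1 ≤ q), (by omega : c ≤ q - 1)] at this ⊢
      linarith
  calc ∑ i ∈ range (n + 2), tupleSumCount q (n + 1) (i * q - j)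
      = ∑ p ∈ range (n + 2) ×ˢ range q, tupleSumCount q n ((p.1 : ℤ) * q - j - p.2) := by
        simp only [tupleSumCount_succ, sum_product]
    _ = ∑ f ∈ Fintype.piFinset fun _ : Fin n => Icc (0 : ℤ) ((q : ℤ) - 1),
          #{p ∈ range (n + 2) ×ˢ range q | ∑ l, f l = (p.1 : ℤ) * q - j - p.2} := by
        simp only [tupleSumCount, card_filter]
        exact sum_comm
    _ = q ^ n := by
        rw [sum_congr rfl hunique]
        simp

theorem sum_range_eq_zero_add_sum_Ico {q : ℕ} (hq : 1 ≤ q) (f : ℕ → ℤ) :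
    ∑ j ∈ range q, f j = f 0 + ∑ j ∈ Ico 1 q, f j := by
  rw [range_eq_Ico, sum_eq_sum_Ico_succ_bot hq]

/-- Summing `aCount` over a full period of offsets. -/
theorem sum_range_aCount (q d : ℕ) (hq : 1 ≤ q) (k : ℤ) :
    ∑ j ∈ range q, (aCount q d k j : ℤ) =
      aCount q (d + 1) (k + 1) 0 - aCount q d (k + 1) 0 + aCount q d k 0 := by
  have hreflect : ∑ j ∈ Ico 1 q, (tupleSumCount q (d + 1) (j + k * q) : ℤ) =
      ∑ j ∈ Ico 1 q, (tupleSumCount q (d + 1) (0 + (k + 1) * q - j) : ℤ) := by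
    refine sum_bij' (fun j _ => q - j) (fun j _ => q - j) ?_ ?_ ?_ ?_ ?_
    all_goals intro j hj; rw [mem_Ico] at hj
    · rw [mem_Ico]; omega
    · rw [mem_Ico]; omega
    · omega
    · omega
    · congr 2
      push_cast [hj.2.le]
      ring
  simp only [aCount_eq_tupleSumCount]
  rw [tupleSumCount_succ q (d + 1), Nat.cast_sum, sum_range_eq_zero_add_sum_Ico hq,
    sum_range_eq_zero_add_sum_Ico hq, hreflect]
  simp only [Nat.cast_zero, sub_zero]
  ring

theorem blowup_b_sum_column (q d r : ℕ) (hq : 1 ≤ q) (hd : 2 ≤ d) (hr1 : 1 ≤ r)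
    (hr2 : r ≤ d - 1) (b : ℕ → ℕ → ℤ)
    (hb : ∀ i k, b i k =
      (aCount q (d - r) (k : ℤ) 0 : ℤ) * (aCount q (r - 1) (i : ℤ) 0 : ℤ) +
        ∑ j ∈ Finset.Ico 1 q,
          (aCount q (d - r) (k : ℤ) (j : ℤ) : ℤ) *
            (aCount q (r - 1) ((i : ℤ) - 1) ((q : ℤ) - (j : ℤ)) : ℤ))
    (k : ℕ) (hk : k ≤ d - r) :
    (∑ i ∈ Finset.range (r + 1), b i k) =
        (q : ℤ) ^ (r - 1) * ∑ j ∈ Finset.range q, (aCount q (d - r) (k : ℤ) (j : ℤ) : ℤ) ∧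
      (∑ i ∈ Finset.range (r + 1), b i k) =
        (q : ℤ) ^ (r - 1) *
          ((aCount q (d - r + 1) ((k : ℤ) + 1) 0 : ℤ) - (aCount q (d - r) ((k : ℤ) + 1) 0 : ℤ) +
            (aCount q (d - r) (k : ℤ) 0 : ℤ)) := by
  rw [← sum_range_aCount q (d - r) hq, and_self]
  have hresidue : ∀ j < q,
      ∑ i ∈ range (r + 1), (tupleSumCount q r (i * q - j) : ℤ) = (q : ℤ) ^ (r - 1) := by
    intro j hj
    obtain ⟨n, rfl⟩ := Nat.exists_eq_add_of_le' hr1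
    exact_mod_cast sum_tupleSumCount_residue q n j hj
  have hzero : ∀ i : ℕ, aCount q (r - 1) i 0 = tupleSumCount q r (i * q - (0 : ℕ)) := by
    intro i
    rw [aCount_eq_tupleSumCount, Nat.sub_add_cancel hr1]
    simp
  have hpos : ∀ i j : ℕ, aCount q (r - 1) ((i : ℤ) - 1) ((q : ℤ) - j) =
      tupleSumCount q r (i * q - j) := by
    intro i j
    rw [aCount_eq_tupleSumCount, Nat.sub_add_cancel hr1]
    congr 1
    ring
  simp only [hb, hzero, hpos]
  rw [sum_add_distrib, sum_comm, ← mul_sum, hresidue 0 hq, sum_range_eq_zero_add_sum_Ico hq,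
    mul_add, mul_sum, Nat.cast_zero, mul_comm]
  congr 1
  refine sum_congr rfl fun j hj => ?_
  rw [← mul_sum, hresidue j (mem_Ico.1 hj).2, mul_comm]
end

section
/- For all integers q ≥ 1 and d ≥ 0, the sum over all (d+1)-tuples (i_0,…,i_d) of integers with 0 ≤ i_j ≤ q−1 of the quantity ⌊(i_0+⋯+i_d)/q⌋ equals d·q^d·(q−1)/2. Equivalently, ∑_{n=0}^{q−1} ∑_{i=0}^{d} i·a_q(i,n;d) = d·q^d·(q−1)/2. -/
open Finset

/-- Hermite's identity for integers. -/
lemma sum_range_add_ediv (q : ℕ) (hq : 1 ≤ q) (s : ℤ) :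
    ∑ k ∈ Finset.range q, (s + k) / (q : ℤ) = s := by
  have hstep (s : ℤ) : ∑ k ∈ Finset.range q, (s + 1 + k) / (q : ℤ) =
      ∑ k ∈ Finset.range q, (s + k) / (q : ℤ) + 1 := by
    have hsub := Finset.sum_range_sub (fun k : ℕ => (s + k) / (q : ℤ)) q
    rw [Finset.sum_sub_distrib, Int.add_ediv_of_dvd_right (dvd_refl (q : ℤ)),
      Int.ediv_self (by omega)] at hsub
    simp only [Nat.cast_add, Nat.cast_one, Nat.cast_zero, add_zero] at hsub
    have hcomm : ∑ k ∈ Finset.range q, (s + 1 + k) / (q : ℤ) =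
        ∑ k ∈ Finset.range q, (s + (k + 1)) / (q : ℤ) :=
      Finset.sum_congr rfl fun k _ => by rw [add_assoc, add_comm (1 : ℤ)]
    linarith
  induction s using Int.induction_on with
  | zero =>
    refine Finset.sum_eq_zero fun k hk => ?_
    rw [Finset.mem_range] at hk
    exact Int.ediv_eq_zero_of_lt (by omega) (by omega)
  | succ n ih => rw [hstep, ih]
  | pred n ih =>
    have h := hstep (-(n : ℤ) - 1)
    rw [sub_add_cancel, ih] at h
    linarith

lemma sum_Icc_add_ediv (q : ℕ) (hq : 1 ≤ q) (s : ℤ) :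
    ∑ k ∈ Finset.Icc (0 : ℤ) ((q : ℤ) - 1), (k + s) / (q : ℤ) = s := by
  refine Eq.trans ?_ (sum_range_add_ediv q hq s)
  refine Finset.sum_nbij' Int.toNat (fun k : ℕ => (k : ℤ)) ?_ ?_ ?_ ?_ ?_
  · intro k hk
    rw [Finset.mem_Icc] at hk
    rw [Finset.mem_range]
    omega
  · intro k hk
    rw [Finset.mem_range] at hk
    rw [Finset.mem_Icc]
    omega
  · intro k hk
    exact Int.toNat_of_nonneg (Finset.mem_Icc.mp hk).1
  · intro k _
    exact Int.toNat_natCast k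
  · intro k hk
    rw [Int.toNat_of_nonneg (Finset.mem_Icc.mp hk).1, add_comm]

lemma sum_piFinset_const_succ {α M : Type*} [AddCommMonoid M] (n : ℕ) (s : Finset α)
    (F : (Fin (n + 1) → α) → M) :
    ∑ f ∈ Fintype.piFinset (fun _ : Fin (n + 1) => s), F f =
      ∑ g ∈ Fintype.piFinset (fun _ : Fin n => s), ∑ k ∈ s, F (Fin.cons k g) := by
  rw [← Finset.sum_product']
  refine Finset.sum_nbij' (fun f => (Fin.tail f, f 0))
    (fun p => (Fin.cons p.2 p.1 : Fin (n + 1) → α)) ?_ ?_ ?_ ?_ ?_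
  · intro f hf
    rw [Fintype.mem_piFinset] at hf
    exact Finset.mem_product.mpr ⟨Fintype.mem_piFinset.mpr fun j => hf j.succ, hf 0⟩
  · intro p hp
    rw [Finset.mem_product, Fintype.mem_piFinset] at hp
    exact Fintype.mem_piFinset.mpr (Fin.cases hp.2 hp.1)
  · intro f _
    exact Fin.cons_self_tail f
  · intro p _
    rfl
  · intro f _
    simp only [Fin.cons_self_tail]

/-- The reflection `g ↦ q - 1 - g` shows that the average of `∑ j, g j` is `n (q - 1) / 2`. -/
lemma two_mul_sum_piFinset_sum (q n : ℕ) :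
    2 * ∑ g ∈ Fintype.piFinset (fun _ : Fin n => Finset.Icc (0 : ℤ) ((q : ℤ) - 1)), ∑ j, g j =
      n * (q : ℤ) ^ n * ((q : ℤ) - 1) := by
  have hrefl :
      ∑ g ∈ Fintype.piFinset (fun _ : Fin n => Finset.Icc (0 : ℤ) ((q : ℤ) - 1)), ∑ j, g j =
      ∑ g ∈ Fintype.piFinset (fun _ : Fin n => Finset.Icc (0 : ℤ) ((q : ℤ) - 1)),
        ∑ j, ((q : ℤ) - 1 - g j) := by
    refine Finset.sum_nbij' (fun g j => (q : ℤ) - 1 - g j) (fun g j => (q : ℤ) - 1 - g j)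
      ?_ ?_ ?_ ?_ ?_
    iterate 2
      intro g hg
      simp only [Fintype.mem_piFinset, Finset.mem_Icc] at hg ⊢
      intro j
      have := hg j
      omega
    all_goals simp
  have hcard : ((Fintype.piFinset
      (fun _ : Fin n => Finset.Icc (0 : ℤ) ((q : ℤ) - 1))).card : ℤ) = (q : ℤ) ^ n := by
    simp
  simp only [Finset.sum_sub_distrib, Finset.sum_const, nsmul_eq_mul, hcard, Finset.card_univ,
    Fintype.card_fin] at hrefl
  linarith

lemma two_mul_sum_piFinset_ediv (q d : ℕ) (hq : 1 ≤ q) :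
    2 * ∑ f ∈ Fintype.piFinset (fun _ : Fin (d + 1) => Finset.Icc (0 : ℤ) ((q : ℤ) - 1)),
      (∑ j, f j) / (q : ℤ) = d * (q : ℤ) ^ d * ((q : ℤ) - 1) := by
  rw [sum_piFinset_const_succ, ← two_mul_sum_piFinset_sum]
  simp only [Fin.sum_cons, sum_Icc_add_ediv q hq]

lemma sum_range_sum_range_ite_eq_ediv (q d : ℕ) (hq : 1 ≤ q) (s : ℤ) (hs : 0 ≤ s)
    (hsd : s < (d + 1) * q) :
    ∑ n ∈ Finset.range q, ∑ i ∈ Finset.range (d + 1),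
      (if s = n + i * q then (i : ℤ) else 0) = s / q := by
  lift s to ℕ using hs
  norm_cast at hsd ⊢
  have hiff (n i : ℕ) (hn : n < q) : s = n + i * q ↔ n = s % q ∧ i = s / q := by
    constructor
    · rintro rfl
      rw [Nat.add_mul_mod_self_right, Nat.mod_eq_of_lt hn,
        Nat.add_mul_div_right _ _ hq, Nat.div_eq_of_lt hn, zero_add]
      exact ⟨rfl, rfl⟩
    · rintro ⟨rfl, rfl⟩
      exact (Nat.mod_add_div' s q).symm
  have hmod : s % q < q := Nat.mod_lt s hq
  have hdiv : s / q < d + 1 := Nat.div_lt_of_lt_mul (by rwa [mul_comm])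
  rw [Finset.sum_eq_single_of_mem (s % q) (Finset.mem_range.mpr hmod),
    Finset.sum_eq_single_of_mem (s / q) (Finset.mem_range.mpr hdiv),
    if_pos (Nat.mod_add_div' s q).symm]
  · intro i _ hi
    exact if_neg fun h => hi ((hiff _ _ hmod).mp h).2
  · intro n hn hne
    exact Finset.sum_eq_zero fun i _ =>
      if_neg fun h => hne ((hiff _ _ (Finset.mem_range.mp hn)).mp h).1

lemma sum_mul_aCount (q d : ℕ) (hq : 1 ≤ q) :
    ∑ n ∈ Finset.range q, ∑ i ∈ Finset.range (d + 1), (i : ℤ) * (aCount q d i n : ℤ) =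
      ∑ f ∈ Fintype.piFinset (fun _ : Fin (d + 1) => Finset.Icc (0 : ℤ) ((q : ℤ) - 1)),
        (∑ j, f j) / (q : ℤ) := by
  have hterm (n i : ℕ) : (i : ℤ) * (aCount q d i n : ℤ) =
      ∑ f ∈ Fintype.piFinset (fun _ : Fin (d + 1) => Finset.Icc (0 : ℤ) ((q : ℤ) - 1)),
        if ∑ j, f j = n + i * q then (i : ℤ) else 0 := by
    rw [aCount, ← Finset.sum_filter, Finset.sum_const, nsmul_eq_mul, mul_comm]
  simp only [hterm]
  rw [Finset.sum_congr rfl fun n _ => Finset.sum_comm, Finset.sum_comm]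
  refine Finset.sum_congr rfl fun f hf => ?_
  simp only [Fintype.mem_piFinset, Finset.mem_Icc] at hf
  refine sum_range_sum_range_ite_eq_ediv q d hq _ (Finset.sum_nonneg fun j _ => (hf j).1) ?_
  calc ∑ j, f j < ∑ _j : Fin (d + 1), (q : ℤ) :=
        Finset.sum_lt_sum_of_nonempty Finset.univ_nonempty fun j _ =>
          Int.lt_of_le_sub_one (hf j).2
    _ = (d + 1) * q := by simp

theorem sum_floor_div_eq (q d : ℕ) (hq : 1 ≤ q) :
    ((∑ f ∈ Fintype.piFinset fun _ : Fin (d + 1) => Finset.Icc (0 : ℤ) ((q : ℤ) - 1),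
        Int.fdiv (∑ j, f j) (q : ℤ) : ℤ) : ℚ) = (d : ℚ) * (q : ℚ) ^ d * ((q : ℚ) - 1) / 2 ∧
      (∑ n ∈ Finset.range q, ∑ i ∈ Finset.range (d + 1),
          (i : ℚ) * (aCount q d (i : ℤ) (n : ℤ) : ℚ)) =
        (d : ℚ) * (q : ℚ) ^ d * ((q : ℚ) - 1) / 2 := by
  have hsum : ((∑ f ∈ Fintype.piFinset fun _ : Fin (d + 1) => Finset.Icc (0 : ℤ) ((q : ℤ) - 1),
      (∑ j, f j) / (q : ℤ) : ℤ) : ℚ) = (d : ℚ) * (q : ℚ) ^ d * ((q : ℚ) - 1) / 2 := by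
    rw [eq_div_iff two_ne_zero, mul_comm]
    exact_mod_cast two_mul_sum_piFinset_ediv q d hq
  constructor
  · simpa only [Int.fdiv_eq_ediv_of_nonneg _ (Int.natCast_nonneg q)] using hsum
  · rw [← hsum, ← sum_mul_aCount q d hq]
    push_cast
    rfl
end
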